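/- Let G be a simple graph on vertex set {1,…,2s} having a perfect matching M with |M| = s, and let n ≥ 1 be an integer. Then there exists α = (α_1,…,α_{2s}) ∈ ℕ^{2s} such that α_u + α_v ≤ n − 1 for every edge {u,v} ∈ M and α_u + α_v ≥ n for every edge {u,v} ∈ E(G) ∖ M, if and only if ν₀(G) = s and n ≥ sdst(J(G)). -/

import Mathlib

open SimpleGraph

namespace DS

variable {V : Type*}

/-- The set of edges of a matching presented by the endpoint functions `u`, `v`. -/
def omEdges {s : ℕ} (u v : Fin s → V) : Set (Sym2 V) := {e | ∃ i, e = s(u i, v i)}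

/-- `(u, v)` describes a matching of size `s` in `G`: the `2s` endpoints are pairwise
distinct (so the edges are pairwise disjoint) and each pair `{u i, v i}` is an edge. -/
def IsMatchingPair (G : SimpleGraph V) {s : ℕ} (u v : Fin s → V) : Prop :=
  Function.Injective (Sum.elim u v) ∧ ∀ i, G.Adj (u i) (v i)

/-- `(u, v)` describes an ordered matching: a matching such that `{u 1, …, u s}` is an
independent set and `{u i, v j} ∈ E(G)` implies `i ≤ j`. -/
def IsOrderedMatching (G : SimpleGraph V) {s : ℕ} (u v : Fin s → V) : Prop :=
  IsMatchingPair G u v ∧ (∀ i j, ¬ G.Adj (u i) (u j)) ∧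
    ∀ i j, G.Adj (u i) (v j) → i ≤ j

/-- The matching number of `G`. -/
noncomputable def nu (G : SimpleGraph V) : ℕ :=
  sSup {s | ∃ u v : Fin s → V, IsMatchingPair G u v}

/-- The ordered matching number of `G`. -/
noncomputable def nu0 (G : SimpleGraph V) : ℕ :=
  sSup {s | ∃ u v : Fin s → V, IsOrderedMatching G u v}

/-- A walk is `M`-alternating if its edges are alternately in `M` and not in `M`. -/
def IsAlt {G : SimpleGraph V} (M : Set (Sym2 V)) {a b : V} (w : G.Walk a b) : Prop :=
  List.Chain' (fun e f => (e ∈ M ↔ f ∉ M)) w.edges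

/-- The walk `w` is nonempty and its first and last edges belong to `M`. -/
def FirstLastInM {G : SimpleGraph V} (M : Set (Sym2 V)) {a b : V} (w : G.Walk a b) : Prop :=
  ∃ h : w.edges ≠ [], w.edges.head h ∈ M ∧ w.edges.getLast h ∈ M

/-- `w` is an `M`-admissible path for the vertex `x` (with respect to the ordered matching
presented by `(u, v)`): an `M`-alternating path with origin `x` whose first and last
edges are in `M`, each of whose edges has an end in `A = range u` and an end in
`B = range v`. -/
def IsAdmissible {G : SimpleGraph V} {s : ℕ} (u v : Fin s → V) {a b : V}
    (w : G.Walk a b) (x : V) : Prop :=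
  a = x ∧ IsAlt (omEdges u v) w ∧ FirstLastInM (omEdges u v) w ∧
    ∀ e ∈ w.edges, ∃ i j, e = s(u i, v j)

/-- `ℓ(x)`: the length of a longest `M`-admissible path for `x`. -/
noncomputable def ellv (G : SimpleGraph V) {s : ℕ} (u v : Fin s → V) (x : V) : ℕ :=
  sSup {n | ∃ (b : V) (w : G.Walk x b), IsAdmissible u v w x ∧ w.length = n}

/-- `ℓ(M)`: the length of a longest `M`-alternating path in `G`. -/
noncomputable def ellM (G : SimpleGraph V) (M : Set (Sym2 V)) : ℕ :=
  sSup {n | ∃ (a b : V) (w : G.Walk a b), IsAlt M w ∧ w.length = n}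

/-- `ℓ₀(M) = max {ℓ(x) : x ∈ B}`. -/
noncomputable def ell0 (G : SimpleGraph V) {s : ℕ} (u v : Fin s → V) : ℕ :=
  sSup {n | ∃ i : Fin s, ellv G u v (v i) = n}

/-- `ℓ₁(M) = max {ℓ(x) + ℓ(y) + 1 : {x, y} ∈ E(G[B])}` (with the convention that this
is `0` when `B` is independent, since `sSup ∅ = 0`). -/
noncomputable def ell1 (G : SimpleGraph V) {s : ℕ} (u v : Fin s → V) : ℕ :=
  sSup {n | ∃ i j : Fin s, G.Adj (v i) (v j) ∧ ellv G u v (v i) + ellv G u v (v j) + 1 = n}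

/-- `ℓ(G) = min {ℓ(M) : M a maximum ordered matching of G}`. -/
noncomputable def ellG (G : SimpleGraph V) : ℕ :=
  sInf {n | ∃ u v : Fin (nu0 G) → V, IsOrderedMatching G u v ∧ ellM G (omEdges u v) = n}

open MvPolynomial in
/-- The `n`-th symbolic power `J(G)^{(n)} = ⋂_{{u,v} ∈ E(G)} (x_u, x_v)^n` of the cover
ideal of `G`. -/
noncomputable def symbPow (K : Type*) [Field K] (G : SimpleGraph V) (n : ℕ) :
    Ideal (MvPolynomial V K) :=
  ⨅ (p : V × V) (_ : G.Adj p.1 p.2), (Ideal.span {X p.1, X p.2}) ^ n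

/-- The cover ideal `J(G) = ⋂_{{u,v} ∈ E(G)} (x_u, x_v)`. -/
noncomputable def coverIdeal (K : Type*) [Field K] (G : SimpleGraph V) :
    Ideal (MvPolynomial V K) :=
  symbPow K G 1

/-- `depth R/I`: the length of a maximal `R/I`-regular sequence contained in the maximal
homogeneous ideal `(x_1, …, x_r)` of `R = K[x_1, …, x_r]`. -/
noncomputable def depthQ (K : Type*) [Field K] (I : Ideal (MvPolynomial V K)) : ℕ :=
  sSup {n | ∃ rs : List (MvPolynomial V K), rs.length = n ∧
    (∀ f ∈ rs, f ∈ Ideal.span (Set.range (MvPolynomial.X : V → MvPolynomial V K))) ∧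
    RingTheory.Sequence.IsRegular (MvPolynomial V K ⧸ I) rs}

/-- The stability index of the symbolic depth function of `J(G)`:
`sdst(J(G)) = min {n₀ ≥ 1 : depth R/J(G)^{(n)} = r − ν₀(G) − 1 for all n ≥ n₀}`. -/
noncomputable def sdst (K : Type*) [Field K] [Fintype V] (G : SimpleGraph V) : ℕ :=
  sInf {n0 | 1 ≤ n0 ∧ ∀ n, n0 ≤ n →
    depthQ K (symbPow K G n) = Fintype.card V - nu0 G - 1}

/-- The stability index of the depth function of `J(G)`:
the least `n₀ ≥ 1` such that `depth R/J(G)^n` is constant for `n ≥ n₀` (hence equal to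
its limit value). -/
noncomputable def dst (K : Type*) [Field K] [Fintype V] (G : SimpleGraph V) : ℕ :=
  sInf {n0 | 1 ≤ n0 ∧ ∀ m n, n0 ≤ m → n0 ≤ n →
    depthQ K (coverIdeal K G ^ m) = depthQ K (coverIdeal K G ^ n)}

end DS

namespace DS

section ExtVanishing

open CategoryTheory Abelian

universe u

variable {R : Type u} [CommRing R] (m : Ideal R)

/-- The groups `Ext^i(R/m, N)` vanish for all `i < d`. -/
def ExtVanish (d : ℕ) (N : Type u) [AddCommGroup N] [Module R N] : Prop :=
  ∀ i < d, Subsingleton (Ext (ModuleCat.of R (R ⧸ m)) (ModuleCat.of R N) i)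

variable {m} {A B C : Type u} [AddCommGroup A] [Module R A] [AddCommGroup B] [Module R B]
  [AddCommGroup C] [Module R C]

lemma ExtVanish.zero : ExtVanish m 0 A := fun _ hi => absurd hi (Nat.not_lt_zero _)

lemma ExtVanish.mono {d e : ℕ} (h : ExtVanish m e A) (hde : d ≤ e) : ExtVanish m d A :=
  fun i hi => h i (hi.trans_le hde)

lemma ExtVanish.of_subsingleton [Subsingleton A] (d : ℕ) : ExtVanish m d A := by
  intro i _
  have : Limits.IsZero (ModuleCat.of R A) := ModuleCat.isZero_of_subsingleton _
  refine ⟨fun x y => ?_⟩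
  rw [← Ext.comp_mk₀_id x, ← Ext.comp_mk₀_id y, this.eq_zero_of_src (𝟙 _)]
  simp

lemma shortExact_of_exact {f : A →ₗ[R] B} {g : B →ₗ[R] C} (hf : Function.Injective f)
    (hg : Function.Surjective g) (hfg : Function.Exact f g) :
    (ShortComplex.mk (ModuleCat.ofHom f) (ModuleCat.ofHom g)
      (by ext x; exact hfg.apply_apply_eq_zero x)).ShortExact where
  exact := by
    rw [ShortComplex.ShortExact.moduleCat_exact_iff_function_exact]
    exact hfg
  mono_f := (ModuleCat.mono_iff_injective _).2 hf
  epi_g := (ModuleCat.epi_iff_surjective _).2 hg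

lemma ExtVanish.middle {f : A →ₗ[R] B} {g : B →ₗ[R] C} (hf : Function.Injective f)
    (hg : Function.Surjective g) (hfg : Function.Exact f g) {d : ℕ}
    (hA : ExtVanish m d A) (hC : ExtVanish m d C) : ExtVanish m d B := by
  intro i hi
  have := hA i hi
  have := hC i hi
  refine subsingleton_of_forall_eq 0 fun x => ?_
  obtain ⟨y, rfl⟩ := Ext.covariant_sequence_exact₂ _ (shortExact_of_exact hf hg hfg) x
    (Subsingleton.elim (α := Ext _ (ModuleCat.of R C) i) _ _)
  rw [Subsingleton.elim (α := Ext _ (ModuleCat.of R A) i) y 0]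
  simp

lemma ExtVanish.right {f : A →ₗ[R] B} {g : B →ₗ[R] C} (hf : Function.Injective f)
    (hg : Function.Surjective g) (hfg : Function.Exact f g) {d : ℕ}
    (hA : ExtVanish m (d + 1) A) (hB : ExtVanish m d B) : ExtVanish m d C := by
  intro i hi
  have := hA (i + 1) (by omega)
  have := hB i hi
  refine subsingleton_of_forall_eq 0 fun x => ?_
  obtain ⟨y, rfl⟩ := Ext.covariant_sequence_exact₃ _ (shortExact_of_exact hf hg hfg) x rfl
    (Subsingleton.elim (α := Ext _ (ModuleCat.of R A) (i + 1)) _ _)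
  rw [Subsingleton.elim (α := Ext _ (ModuleCat.of R B) i) y 0]
  simp

lemma ext_injective_of_vanish {f : A →ₗ[R] B} {g : B →ₗ[R] C} (hf : Function.Injective f)
    (hg : Function.Surjective g) (hfg : Function.Exact f g) {d : ℕ} (hC : ExtVanish m d C)
    {i : ℕ} (hi : i < d + 1) (x : Ext (ModuleCat.of R (R ⧸ m)) (ModuleCat.of R A) i)
    (hx : x.comp (Ext.mk₀ (ModuleCat.ofHom f)) (add_zero i) = 0) : x = 0 := by
  cases i with
  | zero =>
    have : Mono (ModuleCat.ofHom f) := (ModuleCat.mono_iff_injective _).2 hf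
    exact Ext.postcomp_mk₀_injective_of_mono (ModuleCat.of R (R ⧸ m)) (ModuleCat.ofHom f)
      (hx.trans (by simp))
  | succ j =>
    have := hC j (by omega)
    obtain ⟨y, rfl⟩ := Ext.covariant_sequence_exact₁ _ (shortExact_of_exact hf hg hfg) x hx rfl
    rw [Subsingleton.elim (α := Ext _ (ModuleCat.of R C) j) y 0]
    simp

lemma ExtVanish.left {f : A →ₗ[R] B} {g : B →ₗ[R] C} (hf : Function.Injective f)
    (hg : Function.Surjective g) (hfg : Function.Exact f g) {d : ℕ}
    (hB : ExtVanish m (d + 1) B) (hC : ExtVanish m d C) : ExtVanish m (d + 1) A := by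
  intro i hi
  have := hB i hi
  exact subsingleton_of_forall_eq 0 fun x => ext_injective_of_vanish hf hg hfg hC hi x
    (Subsingleton.elim (α := Ext _ (ModuleCat.of R B) i) _ _)

/-- If `r ∈ m` is regular on `A` with cokernel `C`, vanishing for `C` gives one more degree
of vanishing for `A`. -/
lemma ExtVanish.of_regular {r : R} (hr : r ∈ m) {g : A →ₗ[R] C}
    (hf : Function.Injective (LinearMap.lsmul R A r)) (hg : Function.Surjective g)
    (hfg : Function.Exact (LinearMap.lsmul R A r) g) {d : ℕ} (hC : ExtVanish m d C) :
    ExtVanish m (d + 1) A := by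
  intro i hi
  refine subsingleton_of_forall_eq 0 fun x => ext_injective_of_vanish hf hg hfg hC hi x ?_
  have h1 : ModuleCat.ofHom (LinearMap.lsmul R A r) = r • 𝟙 (ModuleCat.of R A) := by
    ext; simp
  have h2 : r • 𝟙 (ModuleCat.of R (R ⧸ m)) = 0 := by
    ext
    change Ideal.Quotient.mk m (r * 1) = 0
    rwa [mul_one, Ideal.Quotient.eq_zero_iff_mem]
  rw [h1, ← Ext.smul_eq_comp_mk₀]
  have h3 : r • x = (Ext.mk₀ (r • 𝟙 (ModuleCat.of R (R ⧸ m)))).comp x (zero_add i) := by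
    simp [Ext.mk₀_smul]
  rw [h3, h2]
  simp

lemma ExtVanish.prod {d : ℕ} (hA : ExtVanish m d A) (hB : ExtVanish m d B) :
    ExtVanish m d (A × B) :=
  .middle (f := LinearMap.inl R A B) (g := LinearMap.snd R A B) LinearMap.inl_injective
    LinearMap.snd_surjective .inl_snd hA hB

lemma not_extVanish_one_residue (hm : m ≠ ⊤) : ¬ ExtVanish m 1 (R ⧸ m) := by
  intro h
  have := h 0 one_pos
  have := Ext.addEquiv₀.symm.subsingleton (β := Ext (ModuleCat.of R (R ⧸ m))
    (ModuleCat.of R (R ⧸ m)) 0)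
  have h1 : 𝟙 (ModuleCat.of R (R ⧸ m)) = 0 := Subsingleton.elim _ _
  have h2 := congrArg (fun f => f.hom (Ideal.Quotient.mk m 1)) h1
  exact hm ((Ideal.eq_top_iff_one m).2 (Ideal.Quotient.eq_zero_iff_mem.1 h2))

/-- Vanishing and the Mayer-Vietoris sequence of two ideals. -/
lemma ExtVanish.sup {I J : Ideal R} {d : ℕ} (hIJ : ExtVanish m (d + 1) (R ⧸ I ⊓ J))
    (hI : ExtVanish m d (R ⧸ I)) (hJ : ExtVanish m d (R ⧸ J)) :
    ExtVanish m d (R ⧸ I ⊔ J) := by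
  let f : (R ⧸ I ⊓ J) →ₗ[R] (R ⧸ I) × (R ⧸ J) :=
    (Submodule.factor inf_le_left).prod (Submodule.factor inf_le_right)
  let g : (R ⧸ I) × (R ⧸ J) →ₗ[R] R ⧸ I ⊔ J :=
    (Submodule.factor le_sup_left).coprod (-Submodule.factor le_sup_right)
  refine .right (f := f) (g := g) ?_ ?_ ?_ hIJ (hI.prod hJ)
  · rw [injective_iff_map_eq_zero]
    intro x hx
    obtain ⟨x, rfl⟩ := Submodule.Quotient.mk_surjective _ x
    have h := Prod.ext_iff.1 hx
    exact (Submodule.Quotient.mk_eq_zero _).2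
      ⟨(Submodule.Quotient.mk_eq_zero _).1 h.1, (Submodule.Quotient.mk_eq_zero _).1 h.2⟩
  · intro x
    obtain ⟨x, rfl⟩ := Submodule.Quotient.mk_surjective _ x
    exact ⟨(Submodule.Quotient.mk x, 0), by simp [g]⟩
  · rintro ⟨x, y⟩
    obtain ⟨x, rfl⟩ := Submodule.Quotient.mk_surjective _ x
    obtain ⟨y, rfl⟩ := Submodule.Quotient.mk_surjective _ y
    constructor
    · intro h
      have h1 : x - y ∈ I ⊔ J := by
        rw [← Submodule.Quotient.mk_eq_zero, ← h]
        simp [g, sub_eq_add_neg]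
      obtain ⟨p, hp, q, hq, hpq⟩ := Submodule.mem_sup.1 h1
      refine ⟨Submodule.Quotient.mk (x - p), Prod.ext ?_ ?_⟩
      · refine (Submodule.Quotient.eq _).2 ?_
        simpa using hp
      · refine (Submodule.Quotient.eq _).2 ?_
        change x - p - y ∈ J
        rwa [show x - p - y = q by rw [sub_right_comm, ← hpq, add_sub_cancel_left]]
    · rintro ⟨z, hz⟩
      obtain ⟨z, rfl⟩ := Submodule.Quotient.mk_surjective _ z
      rw [← hz]
      simp [f, g]

end ExtVanishing

section MonomialIdeals

open MvPolynomial

universe v u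

variable {σ : Type v} {K : Type u} [Field K]

/-- The ideal spanned by the monomials with exponent in `S`. -/
noncomputable def monoIdeal (K : Type u) [Field K] (S : Set (σ →₀ ℕ)) : Ideal (MvPolynomial σ K) :=
  Ideal.span ((fun a => monomial a 1) '' S)

lemma mem_monoIdeal {S : Set (σ →₀ ℕ)} (hS : IsUpperSet S) {p : MvPolynomial σ K} :
    p ∈ monoIdeal K S ↔ ∀ a ∈ p.support, a ∈ S := by
  rw [monoIdeal, mem_ideal_span_monomial_image]
  exact forall₂_congr fun a _ => ⟨fun ⟨b, hb, hba⟩ => hS hba hb, fun h => ⟨a, h, le_rfl⟩⟩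

lemma monoIdeal_inter {S T : Set (σ →₀ ℕ)} (hS : IsUpperSet S) (hT : IsUpperSet T) :
    monoIdeal K (S ∩ T) = monoIdeal K S ⊓ monoIdeal K T := by
  ext p
  rw [Ideal.mem_inf, mem_monoIdeal (hS.inter hT), mem_monoIdeal hS, mem_monoIdeal hT]
  exact ⟨fun h => ⟨fun a ha => (h a ha).1, fun a ha => (h a ha).2⟩,
    fun h a ha => ⟨h.1 a ha, h.2 a ha⟩⟩

lemma monoIdeal_union (S T : Set (σ →₀ ℕ)) :
    monoIdeal K (S ∪ T) = monoIdeal K S ⊔ monoIdeal K T := by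
  rw [monoIdeal, Set.image_union, Ideal.span_union]; rfl

lemma monoIdeal_Ici (c : σ →₀ ℕ) :
    monoIdeal K (Set.Ici c) = Ideal.span {monomial c (1 : K)} := by
  refine le_antisymm (Ideal.span_le.2 ?_) (Ideal.span_mono ?_)
  · rintro _ ⟨a, ha, rfl⟩
    obtain ⟨b, rfl⟩ := exists_add_of_le (Set.mem_Ici.1 ha)
    refine Ideal.mem_span_singleton.2 ⟨monomial b 1, ?_⟩
    rw [monomial_mul, one_mul]
  · rw [Set.singleton_subset_iff]
    exact ⟨c, Set.self_mem_Ici, rfl⟩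

/-- The exponents of the monomials in the colon ideal by the monomial with exponent `c`. -/
def colonSet (S : Set (σ →₀ ℕ)) (c : σ →₀ ℕ) : Set (σ →₀ ℕ) := {a | c + a ∈ S}

lemma isUpperSet_colonSet {S : Set (σ →₀ ℕ)} (hS : IsUpperSet S) (c : σ →₀ ℕ) :
    IsUpperSet (colonSet S c) := fun _ _ hab h => hS (add_le_add_right hab c) h

lemma monomial_mul_mem_monoIdeal {S : Set (σ →₀ ℕ)} (hS : IsUpperSet S) (c : σ →₀ ℕ)
    {p : MvPolynomial σ K} :
    monomial c 1 * p ∈ monoIdeal K S ↔ p ∈ monoIdeal K (colonSet S c) := by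
  rw [mem_monoIdeal hS, mem_monoIdeal (isUpperSet_colonSet hS c)]
  constructor
  · intro h a ha
    refine h (c + a) ?_
    rw [mem_support_iff, coeff_monomial_mul]
    simpa using ha
  · intro h a ha
    rw [mem_support_iff, coeff_monomial_mul'] at ha
    by_cases hca : c ≤ a
    · rw [if_pos hca, one_mul] at ha
      have := h _ (mem_support_iff.2 ha)
      rwa [colonSet, Set.mem_ofPred_eq, add_tsub_cancel_of_le hca] at this
    · simp [hca] at ha

/-- Multiplication by a monomial, from the quotient by the colon ideal. -/
noncomputable def colonMap {S : Set (σ →₀ ℕ)} (hS : IsUpperSet S) (c : σ →₀ ℕ) :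
    (MvPolynomial σ K ⧸ monoIdeal K (colonSet S c)) →ₗ[MvPolynomial σ K]
      MvPolynomial σ K ⧸ monoIdeal K S :=
  Submodule.mapQ _ _ (LinearMap.lsmul (MvPolynomial σ K) (MvPolynomial σ K) (monomial c 1))
    fun _ hp => (monomial_mul_mem_monoIdeal hS c).2 hp

lemma colonMap_injective {S : Set (σ →₀ ℕ)} (hS : IsUpperSet S) (c : σ →₀ ℕ) :
    Function.Injective (colonMap (K := K) hS c) := by
  rw [injective_iff_map_eq_zero]
  intro p hp
  obtain ⟨p, rfl⟩ := Submodule.Quotient.mk_surjective _ p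
  exact (Submodule.Quotient.mk_eq_zero _).2 ((monomial_mul_mem_monoIdeal hS c).1
    ((Submodule.Quotient.mk_eq_zero _).1 hp))

lemma colonMap_exact {S : Set (σ →₀ ℕ)} (hS : IsUpperSet S) (c : σ →₀ ℕ) :
    Function.Exact (colonMap (K := K) hS c)
      (Submodule.factor (Ideal.span_mono (Set.image_mono Set.subset_union_left) :
        monoIdeal K S ≤ monoIdeal K (S ∪ Set.Ici c))) := by
  intro p
  obtain ⟨p, rfl⟩ := Submodule.Quotient.mk_surjective _ p
  constructor
  · intro h
    have h1 : p ∈ monoIdeal K (S ∪ Set.Ici c) := (Submodule.Quotient.mk_eq_zero _).1 h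
    rw [monoIdeal_union, monoIdeal_Ici] at h1
    obtain ⟨q, hq, r, hr, rfl⟩ := Submodule.mem_sup.1 h1
    obtain ⟨s, rfl⟩ := Ideal.mem_span_singleton.1 hr
    refine ⟨Submodule.Quotient.mk s, (Submodule.Quotient.eq _).2 ?_⟩
    change monomial c 1 * s - (q + monomial c 1 * s) ∈ _
    rw [sub_add_cancel_right]
    exact neg_mem hq
  · rintro ⟨q, hq⟩
    obtain ⟨q, rfl⟩ := Submodule.Quotient.mk_surjective _ q
    rw [← hq]
    refine (Submodule.Quotient.mk_eq_zero _).2 ?_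
    change monomial c 1 * q ∈ monoIdeal K (S ∪ Set.Ici c)
    rw [monoIdeal_union, monoIdeal_Ici]
    exact Ideal.mem_sup_right (Ideal.mul_mem_right _ _ (Ideal.mem_span_singleton_self _))

/-- Vanishing of `Ext^i(K, K[σ]/I)` for `i < d`, with `I` the monomial ideal given by `S`. -/
def MonoVanish (K : Type u) [Field K] (d : ℕ) (S : Set (σ →₀ ℕ)) : Prop :=
  ExtVanish (Ideal.span (Set.range (X : σ → MvPolynomial σ K))) d
    (MvPolynomial σ K ⧸ monoIdeal K S)

variable {S T : Set (σ →₀ ℕ)} {d : ℕ}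

lemma MonoVanish.middle (hS : IsUpperSet S) (c : σ →₀ ℕ) (h1 : MonoVanish K d (colonSet S c))
    (h2 : MonoVanish K d (S ∪ Set.Ici c)) : MonoVanish K d S :=
  ExtVanish.middle (colonMap_injective hS c) (Submodule.factor_surjective _)
    (colonMap_exact hS c) h1 h2

lemma MonoVanish.colon (hS : IsUpperSet S) (c : σ →₀ ℕ) (h1 : MonoVanish K (d + 1) S)
    (h2 : MonoVanish K d (S ∪ Set.Ici c)) : MonoVanish K (d + 1) (colonSet S c) :=
  ExtVanish.left (colonMap_injective hS c) (Submodule.factor_surjective _)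
    (colonMap_exact hS c) h1 h2

lemma MonoVanish.union_Ici (hS : IsUpperSet S) (c : σ →₀ ℕ)
    (h1 : MonoVanish K (d + 1) (colonSet S c)) (h2 : MonoVanish K d S) :
    MonoVanish K d (S ∪ Set.Ici c) :=
  ExtVanish.right (colonMap_injective hS c) (Submodule.factor_surjective _)
    (colonMap_exact hS c) h1 h2

lemma MonoVanish.of_free (hS : IsUpperSet S) (x : σ)
    (hx : colonSet S (Finsupp.single x 1) = S)
    (h : MonoVanish K d (S ∪ Set.Ici (Finsupp.single x 1))) : MonoVanish K (d + 1) S := by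
  have key := colonMap_injective (K := K) hS (Finsupp.single x 1)
  have key2 := colonMap_exact (K := K) hS (Finsupp.single x 1)
  refine ExtVanish.of_regular (r := X x) (Ideal.subset_span (Set.mem_range_self x))
    (g := Submodule.factor (Ideal.span_mono (Set.image_mono Set.subset_union_left) :
        monoIdeal K S ≤ monoIdeal K (S ∪ Set.Ici (Finsupp.single x 1)))) ?_
    (Submodule.factor_surjective _) ?_ h
  · rw [injective_iff_map_eq_zero]
    intro p hp
    obtain ⟨p, rfl⟩ := Submodule.Quotient.mk_surjective _ p
    refine (Submodule.Quotient.mk_eq_zero _).2 ?_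
    have h1 := (monomial_mul_mem_monoIdeal hS (Finsupp.single x 1)).1
      ((Submodule.Quotient.mk_eq_zero _).1 hp)
    rwa [hx] at h1
  · intro p
    rw [key2 p]
    constructor
    · rintro ⟨q, rfl⟩
      obtain ⟨q, rfl⟩ := Submodule.Quotient.mk_surjective _ q
      exact ⟨Submodule.Quotient.mk q, rfl⟩
    · rintro ⟨q, rfl⟩
      obtain ⟨q, rfl⟩ := Submodule.Quotient.mk_surjective _ q
      exact ⟨Submodule.Quotient.mk q, rfl⟩

lemma monoVanish_univ : MonoVanish K d (Set.univ : Set (σ →₀ ℕ)) := by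
  have h : monoIdeal K (Set.univ : Set (σ →₀ ℕ)) = ⊤ :=
    (Ideal.eq_top_iff_one _).2 ((mem_monoIdeal isUpperSet_univ).2 fun _ _ => Set.mem_univ _)
  have : Subsingleton (MvPolynomial σ K ⧸ monoIdeal K (Set.univ : Set (σ →₀ ℕ))) :=
    Ideal.Quotient.subsingleton_iff.2 h
  exact ExtVanish.of_subsingleton d

lemma MonoVanish.union (hS : IsUpperSet S) (hT : IsUpperSet T)
    (h : MonoVanish K (d + 1) (S ∩ T)) (h1 : MonoVanish K d S) (h2 : MonoVanish K d T) :
    MonoVanish K d (S ∪ T) := by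
  unfold MonoVanish at *
  rw [monoIdeal_inter hS hT] at h
  rw [monoIdeal_union]
  exact h.sup h1 h2

lemma not_monoVanish_one : ¬ MonoVanish K 1 {a : σ →₀ ℕ | ∃ z, 1 ≤ a z} := by
  have h1 : monoIdeal K {a : σ →₀ ℕ | ∃ z, 1 ≤ a z} =
      Ideal.span (Set.range (X : σ → MvPolynomial σ K)) := by
    refine le_antisymm (Ideal.span_le.2 ?_) (Ideal.span_mono ?_)
    · rintro _ ⟨a, ⟨z, hz⟩, rfl⟩
      obtain ⟨b, rfl⟩ := exists_add_of_le (Finsupp.single_le_iff.2 hz)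
      change monomial (Finsupp.single z 1 + b) (1 : K) ∈ Ideal.span (Set.range X)
      rw [show monomial (Finsupp.single z 1 + b) (1 : K) = X z * monomial b 1 by
        rw [X, monomial_mul, one_mul]]
      exact Ideal.mul_mem_right _ _ (Ideal.subset_span ⟨z, rfl⟩)
    · rintro _ ⟨z, rfl⟩
      exact ⟨Finsupp.single z 1, ⟨z, by simp⟩, rfl⟩
  have h2 : monoIdeal K {a : σ →₀ ℕ | ∃ z, 1 ≤ a z} ≠ ⊤ := by
    rw [Ne, Ideal.eq_top_iff_one, mem_monoIdeal]
    · intro h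
      obtain ⟨z, hz⟩ := h 0 (by simp)
      simp at hz
    · rintro a b hab ⟨z, hz⟩
      exact ⟨z, hz.trans (hab z)⟩
  intro h
  rw [MonoVanish, ← h1] at h
  exact not_extVanish_one_residue h2 h

end MonomialIdeals

section WeightedGraphs

universe v u

variable {σ : Type v} {K : Type u} [Field K]

/-- Exponents of the ideal generated by the variables outside `L`. -/
def deadSet (L : Finset σ) : Set (σ →₀ ℕ) := {a | ∃ z, z ∉ L ∧ 1 ≤ a z}

/-- Exponents of the ideal generated by the variables outside `L` and `⋂ (x_p, x_q)^{w p q}`. -/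
def edgeSet (w : σ → σ → ℕ) (L : Finset σ) : Set (σ →₀ ℕ) :=
  deadSet L ∪ {a | ∀ p ∈ L, ∀ q ∈ L, w p q ≤ a p + a q}

lemma isUpperSet_deadSet (L : Finset σ) : IsUpperSet (deadSet L) :=
  fun _ _ hab ⟨z, hz, h⟩ => ⟨z, hz, h.trans (hab z)⟩

lemma isUpperSet_edgeSet (w : σ → σ → ℕ) (L : Finset σ) : IsUpperSet (edgeSet w L) :=
  (isUpperSet_deadSet L).union fun _ _ hab h p hp q hq =>
    (h p hp q hq).trans (add_le_add (hab p) (hab q))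

lemma edgeSet_congr {w w' : σ → σ → ℕ} {L : Finset σ}
    (h : ∀ p ∈ L, ∀ q ∈ L, w p q = w' p q) : edgeSet w L = edgeSet w' L := by
  ext a
  refine or_congr_right (forall₂_congr fun p hp => forall₂_congr fun q hq => ?_)
  rw [h p hp q hq]

/-- The weights after killing the variable `y` and dividing by the resulting monomial factor. -/
def redWeight (w : σ → σ → ℕ) (y p q : σ) : ℕ := w p q - w y p - w y q

/-- A symmetric weight function vanishing on the diagonal. -/
def IsWeight (w : σ → σ → ℕ) : Prop := (∀ p q, w p q = w q p) ∧ ∀ p, w p p = 0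

lemma IsWeight.redWeight {w : σ → σ → ℕ} (hw : IsWeight w) (y : σ) :
    IsWeight (redWeight w y) := by
  refine ⟨fun p q => ?_, fun p => ?_⟩
  · simp only [DS.redWeight, hw.1 p q, Nat.sub_right_comm]
  · simp [DS.redWeight, hw.2 p]

lemma redWeight_le (w : σ → σ → ℕ) (y p q : σ) : redWeight w y p q ≤ w p q :=
  (Nat.sub_le _ _).trans (Nat.sub_le _ _)

variable [DecidableEq σ]

/-- The weights after a colon by the variable `y`. -/
def decWeight (w : σ → σ → ℕ) (y p q : σ) : ℕ :=
  w p q - (if p = y then 1 else 0) - (if q = y then 1 else 0)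

lemma IsWeight.decWeight {w : σ → σ → ℕ} (hw : IsWeight w) (y : σ) :
    IsWeight (decWeight w y) := by
  refine ⟨fun p q => ?_, fun p => ?_⟩
  · simp only [DS.decWeight, hw.1 p q, Nat.sub_right_comm]
  · simp [DS.decWeight, hw.2 p]

lemma decWeight_le (w : σ → σ → ℕ) (y p q : σ) : decWeight w y p q ≤ w p q :=
  (Nat.sub_le _ _).trans (Nat.sub_le _ _)

lemma sum_decWeight_lt {w : σ → σ → ℕ} {L : Finset σ} {y z : σ} (hy : y ∈ L) (hz : z ∈ L)
    (h : 1 ≤ w y z) :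
    ∑ p ∈ L, ∑ q ∈ L, decWeight w y p q < ∑ p ∈ L, ∑ q ∈ L, w p q := by
  refine Finset.sum_lt_sum
    (fun p _ => Finset.sum_le_sum fun q _ => decWeight_le w y p q) ⟨y, hy, ?_⟩
  refine Finset.sum_lt_sum (fun q _ => decWeight_le w y y q) ⟨z, hz, ?_⟩
  simp only [decWeight, if_true]
  omega

lemma colonSet_edgeSet (w : σ → σ → ℕ) {L : Finset σ} {y : σ} (hy : y ∈ L) :
    colonSet (edgeSet w L) (Finsupp.single y 1) = edgeSet (decWeight w y) L := by
  ext a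
  refine or_congr (exists_congr fun z => and_congr_right fun hz => ?_)
    (forall₂_congr fun p hp => forall₂_congr fun q hq => ?_)
  · have : y ≠ z := fun h => hz (h ▸ hy)
    simp [this]
  · simp only [decWeight, Finsupp.add_apply, Finsupp.single_apply, eq_comm (a := y)]
    omega

lemma monoVanish_deadSet (L : Finset σ) : MonoVanish K L.card (deadSet L) := by
  induction L using Finset.induction_on with
  | empty => exact ExtVanish.zero
  | insert x L hx ih =>
    rw [Finset.card_insert_of_notMem hx]
    refine .of_free (isUpperSet_deadSet _) x ?_ ?_
    · ext a
      refine exists_congr fun z => and_congr_right fun hz => ?_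
      have : x ≠ z := fun h => hz (h ▸ Finset.mem_insert_self _ _)
      simp [this]
    · convert ih using 1
      ext a
      simp only [deadSet, Set.mem_union, Set.mem_ofPred_eq, Set.mem_Ici, Finsupp.single_le_iff,
        Finset.mem_insert, not_or]
      constructor
      · rintro (⟨z, hz, h⟩ | h)
        exacts [⟨z, hz.2, h⟩, ⟨x, hx, h⟩]
      · rintro ⟨z, hz, h⟩
        by_cases hzx : z = x
        · exact Or.inr (hzx ▸ h)
        · exact Or.inl ⟨z, ⟨hzx, hz⟩, h⟩

lemma monoVanish_deadSet_union_Ici {L : Finset σ} {d : ℕ} (hd : d + 1 ≤ L.card) (c : σ →₀ ℕ)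
    (hc : c.support ⊆ L) : MonoVanish K d (deadSet L ∪ Set.Ici c) := by
  refine .union_Ici (isUpperSet_deadSet L) c ?_ ((monoVanish_deadSet L).mono (by omega))
  have : colonSet (deadSet L) c = deadSet L := by
    ext a
    refine exists_congr fun z => and_congr_right fun hz => ?_
    have : c z = 0 := Finsupp.notMem_support_iff.1 fun h => hz (hc h)
    simp [this]
  rw [this]
  exact (monoVanish_deadSet L).mono hd

/-- Killing a variable `y`: the remaining ideal is a monomial times the ideal with
weights `redWeight w y`. -/
lemma monoVanish_edgeSet_union_Ici [Finite σ] {w : σ → σ → ℕ} (hw : IsWeight w) {L : Finset σ}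
    {y : σ} (hy : y ∈ L) {d : ℕ} (hd : d + 2 ≤ L.card)
    (h : MonoVanish K d (edgeSet (redWeight w y) (L.erase y))) :
    MonoVanish K d (edgeSet w L ∪ Set.Ici (Finsupp.single y 1)) := by
  let c : σ →₀ ℕ := Finsupp.equivFunOnFinite.symm fun p => if p ∈ L.erase y then w y p else 0
  have hc : ∀ p ∈ L.erase y, c p = w y p := fun p hp => if_pos hp
  have hc' : ∀ p, p ∉ L.erase y → c p = 0 := fun p hp => if_neg hp
  refine .middle ((isUpperSet_edgeSet w L).union (isUpperSet_Ici _)) c ?_ ?_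
  · convert h using 1
    ext a
    simp only [colonSet, edgeSet, deadSet, Set.mem_union, Set.mem_ofPred_eq, Set.mem_Ici,
      Finsupp.single_le_iff, Finsupp.add_apply]
    constructor
    · rintro ((⟨z, hz, h1⟩ | h1) | h1)
      · have hz' : z ∉ L.erase y := fun h => hz (Finset.mem_of_mem_erase h)
        rw [hc' z hz'] at h1
        exact Or.inl ⟨z, hz', by omega⟩
      · refine Or.inr fun p hp q hq => ?_
        have := h1 p (Finset.mem_of_mem_erase hp) q (Finset.mem_of_mem_erase hq)
        rw [hc p hp, hc q hq] at this
        simp only [redWeight]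
        omega
      · rw [hc' y (Finset.notMem_erase y L)] at h1
        exact Or.inl ⟨y, Finset.notMem_erase y L, by omega⟩
    · rintro (⟨z, hz, h1⟩ | h1)
      · by_cases hzy : z = y
        · subst hzy
          exact Or.inr (by omega)
        · exact Or.inl (Or.inl ⟨z, fun h => hz (Finset.mem_erase.2 ⟨hzy, h⟩), by omega⟩)
      · refine Or.inl (Or.inr fun p hp q hq => ?_)
        by_cases hpy : p = y
        · by_cases hqy : q = y
          · rw [hpy, hqy, hw.2]; omega
          · rw [hc q (Finset.mem_erase.2 ⟨hqy, hq⟩), hpy]; omega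
        · by_cases hqy : q = y
          · rw [hc p (Finset.mem_erase.2 ⟨hpy, hp⟩), hqy, hw.1 p y]; omega
          · have := h1 p (Finset.mem_erase.2 ⟨hpy, hp⟩) q (Finset.mem_erase.2 ⟨hqy, hq⟩)
            rw [hc p (Finset.mem_erase.2 ⟨hpy, hp⟩), hc q (Finset.mem_erase.2 ⟨hqy, hq⟩)]
            simp only [redWeight] at this
            omega
  · have hcard : d + 1 ≤ (L.erase y).card := by
      rw [Finset.card_erase_of_mem hy]; omega
    convert monoVanish_deadSet_union_Ici hcard c ?_ using 1
    · ext a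
      simp only [edgeSet, deadSet, Set.mem_union, Set.mem_ofPred_eq, Set.mem_Ici,
        Finsupp.single_le_iff]
      constructor
      · rintro (((⟨z, hz, h1⟩ | h1) | h1) | h1)
        · exact Or.inl ⟨z, fun h => hz (Finset.mem_of_mem_erase h), h1⟩
        · by_cases hay : 1 ≤ a y
          · exact Or.inl ⟨y, Finset.notMem_erase y L, hay⟩
          · refine Or.inr fun p => ?_
            by_cases hp : p ∈ L.erase y
            · have := h1 y hy p (Finset.mem_of_mem_erase hp)
              rw [hc p hp]
              omega
            · rw [hc' p hp]
              exact Nat.zero_le _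
        · exact Or.inl ⟨y, Finset.notMem_erase y L, h1⟩
        · exact Or.inr h1
      · rintro (⟨z, hz, h1⟩ | h1)
        · by_cases hzy : z = y
          · subst hzy
            exact Or.inl (Or.inr h1)
          · exact Or.inl (Or.inl (Or.inl ⟨z, fun h => hz (Finset.mem_erase.2 ⟨hzy, h⟩), h1⟩))
        · exact Or.inr h1
    · intro p hp
      by_contra h1
      exact Finsupp.mem_support_iff.1 hp (hc' p h1)

lemma monoVanish_edgeSet_of_isolated {w : σ → σ → ℕ} (hw : IsWeight w) {L : Finset σ}
    {z : σ} (hz : z ∈ L) (hwz : ∀ p ∈ L, w z p = 0) {d : ℕ}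
    (h : MonoVanish K d (edgeSet w (L.erase z))) : MonoVanish K (d + 1) (edgeSet w L) := by
  refine .of_free (isUpperSet_edgeSet w L) z ?_ ?_
  · rw [colonSet_edgeSet w hz]
    refine edgeSet_congr fun p hp q hq => ?_
    rw [decWeight]
    split_ifs with h1 h2 h2
    · rw [h1, hwz q hq]
    · rw [h1, hwz q hq]
    · rw [h2, hw.1, hwz p hp]
    · rfl
  · convert h using 1
    ext a
    simp only [edgeSet, deadSet, Set.mem_union, Set.mem_ofPred_eq, Set.mem_Ici,
      Finsupp.single_le_iff]
    constructor
    · rintro ((⟨p, hp, h1⟩ | h1) | h1)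
      · exact Or.inl ⟨p, fun h => hp (Finset.mem_of_mem_erase h), h1⟩
      · exact Or.inr fun p hp q hq =>
          h1 p (Finset.mem_of_mem_erase hp) q (Finset.mem_of_mem_erase hq)
      · exact Or.inl ⟨z, Finset.notMem_erase z L, h1⟩
    · rintro (⟨p, hp, h1⟩ | h1)
      · by_cases hpz : p = z
        · exact Or.inr (hpz ▸ h1)
        · exact Or.inl (Or.inl ⟨p, fun h => hp (Finset.mem_erase.2 ⟨hpz, h⟩), h1⟩)
      · refine Or.inl (Or.inr fun p hp q hq => ?_)
        by_cases hpz : p = z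
        · rw [hpz, hwz q hq]; omega
        · by_cases hqz : q = z
          · rw [hqz, hw.1, hwz p hp]; omega
          · exact h1 p (Finset.mem_erase.2 ⟨hpz, hp⟩) q (Finset.mem_erase.2 ⟨hqz, hq⟩)

/-- The depth of `K[L] / ⋂ (x_p, x_q)^{w p q}` is at least `(|L| - 1) / 2`. -/
lemma monoVanish_edgeSet_of_card [Finite σ] (d : ℕ) {w : σ → σ → ℕ} (hw : IsWeight w)
    {L : Finset σ} (hd : 2 * d + 1 ≤ L.card) : MonoVanish K d (edgeSet w L) := by
  induction d generalizing w L with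
  | zero => exact ExtVanish.zero
  | succ d ih =>
    induction hN : ∑ p ∈ L, ∑ q ∈ L, w p q using Nat.strong_induction_on generalizing w with
    | _ N ihN =>
    by_cases h0 : ∀ e ∈ L ×ˢ L, w e.1 e.2 = 0
    · convert monoVanish_univ
      refine Set.eq_univ_of_forall fun a => Or.inr fun p hp q hq => ?_
      rw [h0 (p, q) (Finset.mk_mem_product hp hq)]
      exact Nat.zero_le _
    · push Not at h0
      obtain ⟨e, he, he0⟩ := h0
      obtain ⟨⟨y, z⟩, hyz, hmax⟩ := Finset.exists_max_image (L ×ˢ L) (fun e => w e.1 e.2) ⟨e, he⟩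
      have hpos : 1 ≤ w y z := (Nat.one_le_iff_ne_zero.2 he0).trans (hmax e he)
      obtain ⟨hy, hz⟩ := Finset.mem_product.1 hyz
      have hzy : z ≠ y := by
        rintro rfl
        simp [hw.2] at hpos
      have hz' : z ∈ L.erase y := Finset.mem_erase.2 ⟨hzy, hz⟩
      refine .middle (isUpperSet_edgeSet w L) (Finsupp.single y 1) ?_ ?_
      · rw [colonSet_edgeSet w hy]
        exact ihN _ (hN ▸ sum_decWeight_lt hy hz hpos) (hw.decWeight y) rfl
      · refine monoVanish_edgeSet_union_Ici hw hy (by omega) ?_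
        refine monoVanish_edgeSet_of_isolated (hw.redWeight y) hz' (fun p hp => ?_) ?_
        · have h1 := hmax (z, p) (Finset.mk_mem_product hz (Finset.mem_of_mem_erase hp))
          simp only [redWeight] at h1 ⊢
          omega
        · refine ih (hw.redWeight y) ?_
          rw [Finset.card_erase_of_mem hz', Finset.card_erase_of_mem hy]
          omega

/-- An exponent meeting all weights on `L` except those of the pairs `{p, τ p}`. -/
def Separates (w : σ → σ → ℕ) (L : Finset σ) (τ : σ → σ) (a : σ → ℕ) : Prop :=
  (∀ p ∈ L, a p + a (τ p) < w p (τ p)) ∧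
    ∀ p ∈ L, ∀ q ∈ L, q ≠ τ p → w p q ≤ a p + a q

lemma erase_erase_closed {τ : σ → σ} (hτ : Function.Involutive τ) {L : Finset σ}
    (hL : ∀ p ∈ L, τ p ∈ L) (x : σ) :
    ∀ p ∈ (L.erase (τ x)).erase x, τ p ∈ (L.erase (τ x)).erase x := by
  intro p hp
  simp only [Finset.mem_erase] at hp ⊢
  exact ⟨fun h => hp.2.1 (h ▸ (hτ p).symm), fun h => hp.1 (hτ.injective h), hL p hp.2.2⟩

lemma card_erase_erase {τ : σ → σ} (hτ' : ∀ p, τ p ≠ p) {L : Finset σ} (hL : ∀ p ∈ L, τ p ∈ L)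
    {x : σ} (hx : x ∈ L) : ((L.erase (τ x)).erase x).card = L.card - 2 := by
  rw [Finset.card_erase_of_mem (Finset.mem_erase.2 ⟨(hτ' x).symm, hx⟩),
    Finset.card_erase_of_mem (hL x hx), Nat.sub_sub]

/-- If the pairs `{p, τ p}` form an ordered perfect matching of `L`, then either the depth
exceeds half of `|L|` or some exponent separates the matching from the other pairs. -/
lemma monoVanish_or_exists_separates [Finite σ] {τ : σ → σ} (hτ : Function.Involutive τ)
    (hτ' : ∀ p, τ p ≠ p) (d : ℕ) {w : σ → σ → ℕ} (hw : IsWeight w) {L : Finset σ}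
    (hL : ∀ p ∈ L, τ p ∈ L) (hd : L.card = 2 * d)
    (hleaf : ∀ L' ⊆ L, L'.Nonempty → (∀ p ∈ L', τ p ∈ L') →
      ∃ x ∈ L', ∀ q ∈ L', q ≠ τ x → w x q = 0) :
    MonoVanish K d (edgeSet w L) ∨ ∃ a, Separates w L τ a := by
  induction d generalizing w L with
  | zero => exact Or.inl ExtVanish.zero
  | succ d ih =>
    obtain ⟨x, hx, hxq⟩ := hleaf L subset_rfl (Finset.card_pos.1 (by omega)) hL
    induction hN : ∑ p ∈ L, ∑ q ∈ L, w p q using Nat.strong_induction_on generalizing w with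
    | _ N ihN =>
    have hy := hL x hx
    have hxy : x ∈ L.erase (τ x) := Finset.mem_erase.2 ⟨(hτ' x).symm, hx⟩
    have hcard := card_erase_erase hτ' hL hx
    rcases Nat.eq_zero_or_pos (w x (τ x)) with h0 | hpos
    · left
      refine monoVanish_edgeSet_of_isolated hw hx (fun q hq => ?_) ?_
      · by_cases h : q = τ x
        · rw [h, h0]
        · exact hxq q hq h
      · refine monoVanish_edgeSet_of_card d hw ?_
        rw [Finset.card_erase_of_mem hx]
        omega
    rcases ihN _ (hN ▸ sum_decWeight_lt hy hx (hw.1 x _ ▸ hpos)) (hw.decWeight (τ x))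
      (fun L' h1 h2 h3 => (hleaf L' h1 h2 h3).imp fun z hz => ⟨hz.1, fun q hq hq' =>
        Nat.eq_zero_of_le_zero ((decWeight_le w _ _ _).trans (hz.2 q hq hq').le)⟩)
      (fun q hq hq' => Nat.eq_zero_of_le_zero ((decWeight_le w _ _ _).trans (hxq q hq hq').le))
      rfl with hdec | ⟨a, ha⟩
    swap
    · refine Or.inr ⟨fun p => a p + if p = τ x then 1 else 0, fun p hp => ?_,
        fun p hp q hq hqp => ?_⟩
      · have := ha.1 p hp
        simp only [decWeight] at this ⊢
        omega
      · have := ha.2 p hp q hq hqp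
        simp only [decWeight] at this ⊢
        omega
    have hmem : ∀ p ∈ L, p ≠ x → p ≠ τ x → p ∈ (L.erase (τ x)).erase x := fun p hp h1 h2 =>
      Finset.mem_erase.2 ⟨h1, Finset.mem_erase.2 ⟨h2, hp⟩⟩
    rcases Nat.eq_zero_or_pos d with rfl | hdpos
    · right
      have hemp : (L.erase (τ x)).erase x = ∅ := Finset.card_eq_zero.1 (by omega)
      have hor : ∀ p ∈ L, p = x ∨ p = τ x := by
        intro p hp
        by_contra! h
        simpa [hemp] using hmem p hp h.1 h.2
      refine ⟨0, fun p hp => ?_, fun p hp q hq hqp => ?_⟩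
      · rcases hor p hp with rfl | rfl
        · simpa using hpos
        · rw [hτ x, hw.1]
          simpa using hpos
      · have hpq : q = p := by
          rcases hor p hp with rfl | rfl <;> rcases hor q hq with rfl | rfl
          · rfl
          · exact absurd rfl hqp
          · exact absurd (hτ q).symm hqp
          · rfl
        rw [hpq, hw.2]
        exact Nat.zero_le _
    rcases ih (hw.redWeight (τ x)) (erase_erase_closed hτ hL x) (by omega)
      (fun L' h1 h2 h3 => (hleaf L' (h1.trans ((Finset.erase_subset _ _).trans
        (Finset.erase_subset _ _))) h2 h3).imp fun z hz => ⟨hz.1, fun q hq hq' =>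
        Nat.eq_zero_of_le_zero ((redWeight_le w _ _ _).trans (hz.2 q hq hq').le)⟩)
      with hred | ⟨a, ha⟩
    · left
      refine .middle (isUpperSet_edgeSet w L) (Finsupp.single (τ x) 1) ?_ ?_
      · rwa [colonSet_edgeSet w hy]
      · refine monoVanish_edgeSet_union_Ici hw hy (by omega) ?_
        refine monoVanish_edgeSet_of_isolated (hw.redWeight _) hxy (fun q hq => ?_) hred
        refine Nat.eq_zero_of_le_zero ((redWeight_le w _ _ _).trans (hxq q ?_ ?_).le)
        exacts [Finset.mem_of_mem_erase hq, Finset.ne_of_mem_erase hq]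
    · right
      let b : σ → ℕ := fun p => if p = x ∨ p = τ x then 0 else a p + w (τ x) p
      have hbx : b x = 0 := if_pos (Or.inl rfl)
      have hby : b (τ x) = 0 := if_pos (Or.inr rfl)
      have hb : ∀ p, p ≠ x → p ≠ τ x → b p = a p + w (τ x) p := fun p h1 h2 =>
        if_neg (not_or.2 ⟨h1, h2⟩)
      refine ⟨b, fun p hp => ?_, fun p hp q hq hqp => ?_⟩
      · by_cases hpx : p = x
        · rw [hpx, hbx, hby]; exact hpos
        by_cases hpy : p = τ x
        · rw [hpy, hτ x, hbx, hby, hw.1]; exact hpos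
        have h1 := ha.1 p (hmem p hp hpx hpy)
        rw [hb p hpx hpy, hb (τ p) (fun h => hpy (h ▸ (hτ p).symm)) (fun h => hpx (hτ.injective h))]
        simp only [redWeight] at h1
        omega
      · by_cases hpx : p = x
        · subst hpx
          rw [hxq q hq hqp]
          exact Nat.zero_le _
        by_cases hqx : q = x
        · subst hqx
          rw [hw.1, hxq p hp fun h => hqp (h ▸ (hτ q).symm)]
          exact Nat.zero_le _
        by_cases hpy : p = τ x
        · by_cases hqy : q = τ x
          · rw [hpy, hqy, hw.2]
            exact Nat.zero_le _
          · rw [hpy, hby, hb q hqx hqy]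
            omega
        · by_cases hqy : q = τ x
          · rw [hqy, hby, hb p hpx hpy, hw.1]
            omega
          · have h1 := ha.2 p (hmem p hp hpx hpy) q (hmem q hq hqx hqy) hqp
            rw [hb p hpx hpy, hb q hqx hqy]
            simp only [redWeight] at h1
            omega

/-- The indicator weights of the pairs `{p, τ p}`. -/
def pairWeight (τ : σ → σ) (p q : σ) : ℕ := if q = τ p then 1 else 0

lemma isWeight_pairWeight {τ : σ → σ} (hτ : Function.Involutive τ) (hτ' : ∀ p, τ p ≠ p) :
    IsWeight (pairWeight τ) := by
  refine ⟨fun p q => ?_, fun p => if_neg (hτ' p).symm⟩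
  simp only [pairWeight, hτ.eq_iff.symm.trans eq_comm]

/-- The cover ideal of `d + 1` disjoint edges on `2 (d + 1)` vertices has depth at most `d`. -/
lemma not_monoVanish_pairWeight [Finite σ] {τ : σ → σ} (hτ : Function.Involutive τ)
    (hτ' : ∀ p, τ p ≠ p) (d : ℕ) {L : Finset σ} (hL : ∀ p ∈ L, τ p ∈ L)
    (hd : L.card = 2 * (d + 1)) : ¬ MonoVanish K (d + 1) (edgeSet (pairWeight τ) L) := by
  induction d generalizing L with
  | zero =>
    obtain ⟨x, hx⟩ := Finset.card_pos.1 (by omega : 0 < L.card)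
    convert not_monoVanish_one (K := K) using 2
    ext a
    simp only [edgeSet, deadSet, Set.mem_union, Set.mem_ofPred_eq]
    constructor
    · rintro (⟨z, -, hz⟩ | h)
      · exact ⟨z, hz⟩
      · have := h x hx _ (hL x hx)
        rw [pairWeight, if_pos rfl] at this
        by_cases hax : 1 ≤ a x
        · exact ⟨x, hax⟩
        · exact ⟨τ x, by omega⟩
    · rintro ⟨z, hz⟩
      by_cases hzL : z ∈ L
      · refine Or.inr fun p hp q hq => ?_
        rw [pairWeight]
        split_ifs with hqp
        · have hemp : (L.erase (τ z)).erase z = ∅ := Finset.card_eq_zero.1 (by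
            rw [card_erase_erase hτ' hL hzL]; omega)
          have hor : p = z ∨ p = τ z := by
            by_contra! h
            have : p ∈ (L.erase (τ z)).erase z :=
              Finset.mem_erase.2 ⟨h.1, Finset.mem_erase.2 ⟨h.2, hp⟩⟩
            simp [hemp] at this
          rcases hor with rfl | rfl
          · omega
          · rw [hτ z] at hqp
            subst hqp
            omega
        · exact Nat.zero_le _
      · exact Or.inl ⟨z, hzL, hz⟩
  | succ d ih =>
    intro hvan
    obtain ⟨x, hx⟩ := Finset.card_pos.1 (by omega : 0 < L.card)
    have hy := hL x hx
    have hxy : x ∈ L.erase (τ x) := Finset.mem_erase.2 ⟨(hτ' x).symm, hx⟩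
    have hcard := card_erase_erase hτ' hL hx
    set L₂ := (L.erase (τ x)).erase x with hL₂
    have hmem : ∀ p, p ∈ L₂ ↔ p ∈ L ∧ p ≠ x ∧ p ≠ τ x := by
      intro p
      simp only [hL₂, Finset.mem_erase]
      tauto
    have hclosed : ∀ p ∈ L₂, τ p ∈ L₂ := erase_erase_closed hτ hL x
    refine ih hclosed (by omega) ?_
    let w : σ → σ → ℕ := fun p q => if p ∈ L₂ ∧ q ∈ L₂ then pairWeight τ p q else 0
    have hpw := isWeight_pairWeight hτ hτ'
    have hw : IsWeight w := by
      refine ⟨fun p q => ?_, fun p => ?_⟩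
      · simp only [w, and_comm (a := p ∈ L₂), hpw.1 p q]
      · simp [w, hpw.2 p]
    have hxL₂ : x ∉ L₂ := fun h => ((hmem x).1 h).2.1 rfl
    have hyL₂ : τ x ∉ L₂ := fun h => ((hmem _).1 h).2.2 rfl
    have hS₁ : MonoVanish K (d + 1) (edgeSet w L) := by
      refine monoVanish_edgeSet_of_isolated hw hy (fun p _ => if_neg fun h => hyL₂ h.1) ?_
      refine (monoVanish_edgeSet_of_isolated hw hxy (fun p _ => if_neg fun h => hxL₂ h.1)
        (monoVanish_edgeSet_of_card d hw ?_)).mono (Nat.le_succ d)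
      change _ ≤ L₂.card
      omega
    have hS₂ : MonoVanish K (d + 1) (deadSet L₂) := (monoVanish_deadSet L₂).mono (by omega)
    have hinter : edgeSet w L ∩ deadSet L₂ = edgeSet (pairWeight τ) L := by
      ext a
      simp only [edgeSet, deadSet, Set.mem_union, Set.mem_inter_iff, Set.mem_ofPred_eq]
      constructor
      · rintro ⟨h | h, z, hz, haz⟩
        · exact Or.inl h
        · by_cases hzL : z ∈ L
          · refine Or.inr fun p hp q hq => ?_
            by_cases hp2 : p ∈ L₂
            · by_cases hq2 : q ∈ L₂
              · have := h p hp q hq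
                rwa [show w p q = pairWeight τ p q from if_pos ⟨hp2, hq2⟩] at this
              · rw [pairWeight, if_neg]
                · exact Nat.zero_le _
                · rintro rfl
                  exact hq2 (hclosed p hp2)
            · rw [pairWeight]
              split_ifs with hqp
              · have h1 : z = x ∨ z = τ x := by
                  by_contra! h1
                  exact hz ((hmem z).2 ⟨hzL, h1⟩)
                have h2 : p = x ∨ p = τ x := by
                  by_contra! h2
                  exact hp2 ((hmem p).2 ⟨hp, h2⟩)
                have h3 : z = p ∨ z = q := by
                  rcases h1 with rfl | rfl <;> rcases h2 with rfl | rfl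
                  · exact Or.inl rfl
                  · exact Or.inr (hqp.trans (hτ _)).symm
                  · exact Or.inr hqp.symm
                  · exact Or.inl rfl
                rcases h3 with rfl | rfl <;> omega
              · exact Nat.zero_le _
          · exact Or.inl ⟨z, hzL, haz⟩
      · rintro (⟨z, hz, haz⟩ | h)
        · exact ⟨Or.inl ⟨z, hz, haz⟩, z, fun h => hz ((hmem z).1 h).1, haz⟩
        · refine ⟨Or.inr fun p hp q hq => ?_, ?_⟩
          · refine le_trans ?_ (h p hp q hq)
            simp only [w]
            split_ifs
            exacts [le_rfl, Nat.zero_le _]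
          · have h1 := h x hx _ hy
            rw [pairWeight, if_pos rfl] at h1
            by_cases hax : 1 ≤ a x
            · exact ⟨x, hxL₂, hax⟩
            · exact ⟨τ x, hyL₂, by omega⟩
    have hunion : edgeSet w L ∪ deadSet L₂ = edgeSet (pairWeight τ) L₂ := by
      ext a
      simp only [edgeSet, deadSet, Set.mem_union, Set.mem_ofPred_eq]
      constructor
      · rintro ((⟨z, hz, haz⟩ | h) | h)
        · exact Or.inl ⟨z, fun h => hz ((hmem z).1 h).1, haz⟩
        · refine Or.inr fun p hp q hq => ?_
          have := h p ((hmem p).1 hp).1 q ((hmem q).1 hq).1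
          rwa [show w p q = pairWeight τ p q from if_pos ⟨hp, hq⟩] at this
        · exact Or.inl h
      · rintro (h | h)
        · exact Or.inr h
        · refine Or.inl (Or.inr fun p hp q hq => ?_)
          simp only [w]
          split_ifs with h1
          exacts [h p h1.1 q h1.2, Nat.zero_le _]
    rw [← hunion]
    exact .union (isUpperSet_edgeSet w L) (isUpperSet_deadSet L₂) (hinter ▸ hvan) hS₁ hS₂

/-- A separating exponent bounds the depth. -/
lemma not_monoVanish_of_separates [Finite σ] {τ : σ → σ} (hτ : Function.Involutive τ)
    (hτ' : ∀ p, τ p ≠ p) {d : ℕ} {w : σ → σ → ℕ} (hw : IsWeight w) {L : Finset σ}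
    (hL : ∀ p ∈ L, τ p ∈ L) (hd : L.card = 2 * (d + 1)) {a : σ → ℕ}
    (ha : Separates w L τ a) : ¬ MonoVanish K (d + 1) (edgeSet w L) := by
  induction hN : ∑ p ∈ L, ∑ q ∈ L, w p q using Nat.strong_induction_on generalizing w a with
  | _ N ihN =>
  have step : ∀ y ∈ L, (∃ b, Separates (decWeight w y) L τ b) →
      ¬ MonoVanish K (d + 1) (edgeSet w L) := by
    rintro y hy ⟨b, hb⟩ h
    have hpos : 1 ≤ w y (τ y) := (Nat.zero_le _).trans_lt (ha.1 y hy)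
    refine ihN _ (hN ▸ sum_decWeight_lt hy (hL y hy) hpos) (hw.decWeight y) hb rfl ?_
    rw [← colonSet_edgeSet w hy]
    refine .colon (isUpperSet_edgeSet w L) _ h ?_
    refine monoVanish_edgeSet_union_Ici hw hy (by omega)
      (monoVanish_edgeSet_of_card d (hw.redWeight y) ?_)
    rw [Finset.card_erase_of_mem hy]
    omega
  by_cases h1 : ∃ y ∈ L, 1 ≤ a y
  · obtain ⟨y, hy, hay⟩ := h1
    refine step y hy ⟨fun p => a p - if p = y then 1 else 0, fun p hp => ?_,
      fun p hp q hq hqp => ?_⟩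
    · have h2 := ha.1 p hp
      have h3 : p = y → 1 ≤ a p := fun h => h ▸ hay
      have h4 : τ p = y → 1 ≤ a (τ p) := fun h => h ▸ hay
      simp only [decWeight]
      split_ifs <;> simp_all <;> omega
    · have h2 := ha.2 p hp q hq hqp
      simp only [decWeight]
      split_ifs <;> simp_all <;> omega
  push Not at h1
  by_cases h2 : ∃ y ∈ L, 2 ≤ w y (τ y)
  · obtain ⟨y, hy, hwy⟩ := h2
    refine step y hy ⟨a, fun p hp => ?_, fun p hp q hq hqp =>
      (decWeight_le w y p q).trans (ha.2 p hp q hq hqp)⟩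
    have h3 := ha.1 p hp
    have h4 := h1 p hp
    have h5 := h1 _ (hL p hp)
    simp only [decWeight]
    by_cases hpy : p = y
    · subst hpy
      simp only [if_true, if_neg (hτ' p)]
      omega
    · by_cases hpy' : τ p = y
      · have : 2 ≤ w p (τ p) := by
          rw [hw.1]
          simpa [← hpy', hτ p] using hwy
        simp only [if_neg hpy, if_pos hpy']
        omega
      · simp only [if_neg hpy, if_neg hpy']
        omega
  push Not at h2
  rw [edgeSet_congr (w' := pairWeight τ)]
  · exact not_monoVanish_pairWeight hτ hτ' d hL hd
  · intro p hp q hq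
    rw [pairWeight]
    split_ifs with hqp
    · subst hqp
      have := ha.1 p hp
      have := h2 p hp
      omega
    · have := ha.2 p hp q hq hqp
      have := h1 p hp
      have := h1 q hq
      omega

end WeightedGraphs

section Depth

open MvPolynomial

universe v u

variable {σ : Type v} {K : Type u} [Field K]

lemma span_range_X_ne_top :
    Ideal.span (Set.range (X : σ → MvPolynomial σ K)) ≠ ⊤ := by
  intro h
  have hle : Ideal.span (Set.range (X : σ → MvPolynomial σ K)) ≤
      RingHom.ker (constantCoeff (σ := σ) (R := K)) := by
    rw [Ideal.span_le]
    rintro _ ⟨x, rfl⟩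
    simp [RingHom.mem_ker]
  have h1 : (1 : MvPolynomial σ K) ∈ RingHom.ker (constantCoeff (σ := σ) (R := K)) :=
    hle (h ▸ Submodule.mem_top)
  simp [RingHom.mem_ker] at h1

lemma smul_top_quotient_lt_top {R : Type u} [CommRing R] {I m : Ideal R} (hm : m ≠ ⊤)
    (hI : I ≤ m) : m • (⊤ : Submodule R (R ⧸ I)) < ⊤ := by
  refine lt_top_iff_ne_top.2 fun h => hm ?_
  have h1 := congrArg (Submodule.map (Submodule.factor hI)) h
  rw [Submodule.map_smul'', Submodule.map_top, LinearMap.range_eq_top.2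
    (Submodule.factor_surjective hI)] at h1
  have h2 : (Submodule.Quotient.mk 1 : R ⧸ m) ∈ m • (⊤ : Submodule R (R ⧸ m)) :=
    h1.symm ▸ (Submodule.mem_top : _ ∈ (⊤ : Submodule R (R ⧸ m)))
  have h3 : m • (⊤ : Submodule R (R ⧸ m)) = ⊥ := by
    rw [eq_bot_iff, Submodule.smul_le]
    intro r hr x _
    obtain ⟨x, rfl⟩ := Submodule.Quotient.mk_surjective _ x
    rw [Submodule.mem_bot, ← Submodule.Quotient.mk_smul, Submodule.Quotient.mk_eq_zero]
    exact Ideal.mul_mem_right _ _ hr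
  rw [h3, Submodule.mem_bot, Submodule.Quotient.mk_eq_zero] at h2
  exact (Ideal.eq_top_iff_one _).2 h2

/-- The Rees theorem for quotient rings. -/
lemma exists_isRegular_iff_extVanish {R : Type u} [CommRing R] [IsNoetherianRing R]
    {I m : Ideal R} (hm : m ≠ ⊤) (hI : I ≤ m) (n : ℕ) :
    (∃ rs : List R, rs.length = n ∧ (∀ f ∈ rs, f ∈ m) ∧
      RingTheory.Sequence.IsRegular (R ⧸ I) rs) ↔ ExtVanish m n (R ⧸ I) := by
  have hlt := smul_top_quotient_lt_top hm hI
  have hsupp : Module.support R (R ⧸ m) = PrimeSpectrum.zeroLocus m := by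
    rw [Module.support_eq_zeroLocus, Ideal.annihilator_quotient]
  constructor
  · rintro ⟨rs, rfl, hrs, hreg⟩
    exact ModuleCat.subsingleton_ext_of_exists_isRegular m (ModuleCat.of R (R ⧸ m)) hsupp.le
      (ModuleCat.of R (R ⧸ I)) hlt rs hrs hreg
  · exact ModuleCat.exists_isRegular_of_exists_subsingleton_ext m n (ModuleCat.of R (R ⧸ I)) hlt
      (ModuleCat.of R (R ⧸ m)) hsupp

lemma depthQ_top : depthQ K (⊤ : Ideal (MvPolynomial σ K)) = 0 := by
  refine (congrArg sSup (Set.eq_empty_of_forall_notMem ?_)).trans csSup_empty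
  rintro n ⟨rs, -, -, h⟩
  have := h.nontrivial
  exact not_subsingleton _ (Ideal.Quotient.subsingleton_iff.2 (rfl : (⊤ : Ideal
    (MvPolynomial σ K)) = ⊤))

variable [Finite σ] {S : Set (σ →₀ ℕ)} {I : Ideal (MvPolynomial σ K)} {d : ℕ}

lemma depthQ_eq_of_monoVanish (hI : I = monoIdeal K S)
    (hle : I ≤ Ideal.span (Set.range X)) (h1 : MonoVanish K d S) (h2 : ¬ MonoVanish K (d + 1) S) :
    depthQ K I = d := by
  subst hI
  have h := exists_isRegular_iff_extVanish span_range_X_ne_top hle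
  refine IsGreatest.csSup_eq ⟨(h d).2 h1, fun n hn => ?_⟩
  by_contra! hlt
  exact h2 (((h n).1 hn).mono hlt)

lemma not_monoVanish_of_depthQ_eq (hI : I = monoIdeal K S)
    (hle : I ≤ Ideal.span (Set.range X)) (hd : d ≠ 0) (h1 : depthQ K I = d) :
    ¬ MonoVanish K (d + 1) S := by
  subst hI
  intro h2
  have h := exists_isRegular_iff_extVanish span_range_X_ne_top hle
  rw [depthQ] at h1
  by_cases hb : BddAbove {n | ∃ rs : List (MvPolynomial σ K), rs.length = n ∧
      (∀ f ∈ rs, f ∈ Ideal.span (Set.range (X : σ → MvPolynomial σ K))) ∧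
      RingTheory.Sequence.IsRegular (MvPolynomial σ K ⧸ monoIdeal K S) rs}
  · have := le_csSup hb ((h (d + 1)).2 h2)
    omega
  · rw [Nat.sSup_of_not_bddAbove hb] at h1
    exact hd h1.symm

end Depth

section CoverIdeals

open MvPolynomial

universe v u

variable {σ : Type v} {K : Type u} [Field K]

lemma isUpperSet_le_add (x y : σ) (n : ℕ) : IsUpperSet {a : σ →₀ ℕ | n ≤ a x + a y} :=
  fun _ _ hab h => le_trans h (add_le_add (hab x) (hab y))

lemma span_pair_X_pow {x y : σ} (hxy : x ≠ y) (n : ℕ) :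
    (Ideal.span {X x, X y} : Ideal (MvPolynomial σ K)) ^ n =
      monoIdeal K {a | n ≤ a x + a y} := by
  refine le_antisymm ?_ (Ideal.span_le.2 ?_)
  · induction n with
    | zero =>
      rw [(Ideal.eq_top_iff_one (monoIdeal K _)).2
        ((mem_monoIdeal (isUpperSet_le_add x y 0)).2 fun _ _ => Nat.zero_le _)]
      exact le_top
    | succ n ih =>
      rw [pow_succ]
      refine (Ideal.mul_mono_left ih).trans ?_
      rw [monoIdeal, monoIdeal, Ideal.span_mul_span', Ideal.span_le]
      rintro _ ⟨_, ⟨a, ha, rfl⟩, _, hz, rfl⟩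
      have ha : n ≤ a x + a y := ha
      rcases hz with rfl | rfl
      · refine Ideal.subset_span ⟨a + Finsupp.single x 1, ?_, by simp [X, monomial_mul]⟩
        simp only [Set.mem_ofPred_eq, Finsupp.add_apply, Finsupp.single_eq_same]
        omega
      · refine Ideal.subset_span ⟨a + Finsupp.single y 1, ?_, by simp [X, monomial_mul]⟩
        simp only [Set.mem_ofPred_eq, Finsupp.add_apply, Finsupp.single_eq_same]
        omega
  · rintro _ ⟨a, ha, rfl⟩
    refine Ideal.pow_le_pow_right ha ?_
    have hle : Finsupp.single x (a x) + Finsupp.single y (a y) ≤ a := by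
      classical
      intro z
      simp only [Finsupp.add_apply, Finsupp.single_apply]
      split_ifs with h1 h2 h2
      · exact absurd (h1.trans h2.symm) hxy
      · simp [h1]
      · simp [h2]
      · exact Nat.zero_le _
    obtain ⟨b, hb⟩ := exists_add_of_le hle
    have : monomial a (1 : K) = X x ^ a x * X y ^ a y * monomial b 1 := by
      rw [X_pow_eq_monomial, X_pow_eq_monomial, monomial_mul, monomial_mul, ← hb]
      simp
    change monomial a (1 : K) ∈ _
    rw [this, pow_add]
    exact Ideal.mul_mem_right _ _ (Ideal.mul_mem_mul
      (Ideal.pow_mem_pow (Ideal.subset_span (by simp)) _)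
      (Ideal.pow_mem_pow (Ideal.subset_span (by simp)) _))

open Classical in
/-- The weight `n` on each edge of `G`. -/
noncomputable def graphWeight (G : SimpleGraph σ) (n : ℕ) (p q : σ) : ℕ :=
  if G.Adj p q then n else 0

lemma graphWeight_of_adj {G : SimpleGraph σ} {p q : σ} (h : G.Adj p q) (n : ℕ) :
    graphWeight G n p q = n := if_pos h

lemma graphWeight_of_not_adj {G : SimpleGraph σ} {p q : σ} (h : ¬ G.Adj p q) (n : ℕ) :
    graphWeight G n p q = 0 := if_neg h

lemma isWeight_graphWeight (G : SimpleGraph σ) (n : ℕ) : IsWeight (graphWeight G n) := by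
  refine ⟨fun p q => ?_, fun p => graphWeight_of_not_adj G.irrefl n⟩
  by_cases h : G.Adj p q
  · rw [graphWeight_of_adj h, graphWeight_of_adj h.symm]
  · rw [graphWeight_of_not_adj h, graphWeight_of_not_adj fun h' => h h'.symm]

lemma symbPow_eq_monoIdeal [Fintype σ] (G : SimpleGraph σ) (n : ℕ) :
    symbPow K G n = monoIdeal K (edgeSet (graphWeight G n) Finset.univ) := by
  ext f
  simp only [symbPow, Ideal.mem_iInf, mem_monoIdeal (isUpperSet_edgeSet _ _)]
  constructor
  · intro h a ha
    refine Or.inr fun p _ q _ => ?_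
    by_cases hpq : G.Adj p q
    · have := h (p, q) hpq
      rw [span_pair_X_pow hpq.ne, mem_monoIdeal (isUpperSet_le_add _ _ n)] at this
      rw [graphWeight_of_adj hpq]
      exact this a ha
    · rw [graphWeight_of_not_adj hpq]
      exact Nat.zero_le _
  · rintro h ⟨p, q⟩ hpq
    rw [span_pair_X_pow hpq.ne, mem_monoIdeal (isUpperSet_le_add _ _ n)]
    intro a ha
    rcases h a ha with ⟨z, hz, -⟩ | h
    · exact absurd (Finset.mem_univ z) hz
    · have := h p (Finset.mem_univ p) q (Finset.mem_univ q)
      rwa [graphWeight_of_adj hpq] at this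

lemma symbPow_le_span_range_X {G : SimpleGraph σ} {p q : σ} (hpq : G.Adj p q) {n : ℕ}
    (hn : n ≠ 0) : symbPow K G n ≤ Ideal.span (Set.range X) := by
  refine (iInf₂_le (p, q) hpq).trans ((Ideal.pow_le_self hn).trans (Ideal.span_mono ?_))
  rintro _ (rfl | rfl)
  exacts [⟨p, rfl⟩, ⟨q, rfl⟩]

end CoverIdeals

section PerfectMatchings

universe v u

variable {σ : Type v} {t : ℕ} {a b : Fin t → σ} {τ : σ → σ}

/-- The involution exchanging the endpoints of a perfect matching. -/
lemma exists_partner (h : Function.Bijective (Sum.elim a b)) :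
    ∃ τ : σ → σ, Function.Involutive τ ∧ (∀ p, τ p ≠ p) ∧ ∀ i, τ (a i) = b i := by
  let e := Equiv.ofBijective _ h
  have he : ∀ z, e.symm (Sum.elim a b z) = z := e.symm_apply_apply
  have hs := h.2
  refine ⟨fun p => e (e.symm p).swap, fun p => by simp, fun p hp => ?_, fun i => ?_⟩
  · have := e.injective (hp.trans (e.apply_symm_apply p).symm)
    cases hz : e.symm p <;> simp [hz] at this
  · have : e.symm (a i) = Sum.inl i := he (Sum.inl i)
    simp only [this]
    rfl

lemma mem_omEdges_iff_eq_partner (hτ : Function.Involutive τ)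
    (hs : Function.Surjective (Sum.elim a b)) (hab : ∀ i, τ (a i) = b i) {p q : σ} :
    s(p, q) ∈ omEdges a b ↔ q = τ p := by
  constructor
  · rintro ⟨i, hi⟩
    rcases Sym2.eq_iff.1 hi with ⟨rfl, rfl⟩ | ⟨rfl, rfl⟩
    · exact (hab i).symm
    · rw [← hab i, hτ]
  · rintro rfl
    obtain ⟨i | i, rfl⟩ := hs p
    · exact ⟨i, by simp [hab]⟩
    · exact ⟨i, by simp [← hab, hτ (a i), Sym2.eq_swap]⟩

lemma adj_partner {G : SimpleGraph σ} (hτ : Function.Involutive τ)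
    (hs : Function.Surjective (Sum.elim a b)) (hab : ∀ i, τ (a i) = b i)
    (hadj : ∀ i, G.Adj (a i) (b i)) (p : σ) : G.Adj p (τ p) := by
  obtain ⟨i | i, rfl⟩ := hs p
  · simpa [hab] using hadj i
  · simpa [← hab, hτ (a i)] using (hadj i).symm

lemma separates_graphWeight_iff [Fintype σ] {G : SimpleGraph σ} (hadj : ∀ p, G.Adj p (τ p))
    {n : ℕ} {α : σ → ℕ} :
    Separates (graphWeight G n) Finset.univ τ α ↔
      (∀ p, α p + α (τ p) < n) ∧ ∀ p q, G.Adj p q → q ≠ τ p → n ≤ α p + α q := by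
  simp only [Separates, Finset.mem_univ, true_imp_iff, graphWeight_of_adj (hadj _)]
  refine and_congr_right fun _ => forall₂_congr fun p q => ?_
  by_cases h : G.Adj p q
  · simp [graphWeight_of_adj h, h]
  · simp [graphWeight_of_not_adj h, h]

lemma bijective_sumElim_of_injective [Fintype σ] (hcard : Fintype.card σ = 2 * t)
    (h : Function.Injective (Sum.elim a b)) : Function.Bijective (Sum.elim a b) :=
  (Fintype.bijective_iff_injective_and_card _).2 ⟨h, by simp [hcard, two_mul]⟩

lemma bijective_sumElim_of_surjective [Fintype σ] (hcard : Fintype.card σ = 2 * t)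
    (h : Function.Surjective (Sum.elim a b)) : Function.Bijective (Sum.elim a b) :=
  (Fintype.bijective_iff_surjective_and_card _).2 ⟨h, by simp [hcard, two_mul]⟩

lemma mem_upperBounds_orderedMatching [Fintype σ] (G : SimpleGraph σ)
    (hcard : Fintype.card σ = 2 * t) :
    t ∈ upperBounds {s | ∃ u v : Fin s → σ, IsOrderedMatching G u v} := by
  rintro s ⟨u, v, h, -⟩
  have := Fintype.card_le_of_injective _ h.1
  simp only [Fintype.card_sum, Fintype.card_fin] at this
  omega

lemma exists_orderedMatching_of_separates [Fintype σ] {G : SimpleGraph σ}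
    (hcard : Fintype.card σ = 2 * t) (hτ : Function.Involutive τ)
    (hs : Function.Surjective (Sum.elim a b)) (hab : ∀ i, τ (a i) = b i)
    (hadj : ∀ p, G.Adj p (τ p)) {n : ℕ} {α : σ → ℕ}
    (hα : Separates (graphWeight G n) Finset.univ τ α) :
    ∃ u v : Fin t → σ, IsOrderedMatching G u v ∧ ∀ i, τ (u i) = v i := by
  rw [separates_graphWeight_iff hadj] at hα
  let c : Fin t → σ := fun i => if α (a i) ≤ α (b i) then a i else b i
  have hc : ∀ i, α (c i) ≤ α (τ (c i)) := by
    intro i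
    simp only [c]
    split_ifs with h
    · rwa [hab]
    · rw [← hab, hτ, hab]
      exact (not_le.1 h).le
  let π := Tuple.sort fun i => OrderDual.toDual (α (c i))
  have hπ : ∀ i j, i ≤ j → α (c (π j)) ≤ α (c (π i)) :=
    fun i j hij => Tuple.monotone_sort (fun i => OrderDual.toDual (α (c i))) hij
  have hsurj : Function.Surjective (Sum.elim (fun i => c (π i)) fun i => τ (c (π i))) := by
    intro p
    obtain ⟨i, hi⟩ : ∃ i, p = c i ∨ p = τ (c i) := by
      obtain ⟨i | i, rfl⟩ := hs p
      · refine ⟨i, ?_⟩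
        simp only [c, Sum.elim_inl]
        split_ifs
        · exact Or.inl rfl
        · exact Or.inr (by rw [← hab, hτ])
      · refine ⟨i, ?_⟩
        simp only [c, Sum.elim_inr]
        split_ifs
        · exact Or.inr (hab i).symm
        · exact Or.inl rfl
    obtain ⟨j, rfl⟩ := π.surjective i
    rcases hi with rfl | rfl
    exacts [⟨Sum.inl j, rfl⟩, ⟨Sum.inr j, rfl⟩]
  have hbij := bijective_sumElim_of_surjective hcard hsurj
  refine ⟨_, _, ⟨⟨hbij.1, fun i => hadj _⟩, fun i j hij => ?_, fun i j hij => ?_⟩, fun i => rfl⟩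
  · have h1 := hα.2 _ _ hij fun h => by
      simpa using @hbij.1 (Sum.inl j) (Sum.inr i) h
    have := hα.1 (c (π i))
    have := hα.1 (c (π j))
    have := hc (π i)
    have := hc (π j)
    omega
  · by_contra! hji
    have h1 := hα.2 _ _ hij fun h => hji.ne (by
      simpa using @hbij.1 (Sum.inr j) (Sum.inr i) h)
    have := hα.1 (c (π j))
    have := hπ j i hji.le
    omega

/-- In a graph with a perfect ordered matching there is no other perfect matching. -/
lemma partner_eq_of_isOrderedMatching {G : SimpleGraph σ} (hτ : Function.Involutive τ)
    (hadj : ∀ p, G.Adj p (τ p)) (h : IsOrderedMatching G a b)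
    (hs : Function.Surjective (Sum.elim a b)) (i : Fin t) : τ (a i) = b i := by
  have hex : ∀ i, ∃ j, b j = τ (a i) := by
    intro i
    obtain ⟨j | j, hj⟩ := hs (τ (a i))
    · have h1 := hadj (a i)
      rw [← hj] at h1
      exact absurd h1 (h.2.1 i j)
    · exact ⟨j, hj⟩
  choose f hf using hex
  have hle : ∀ i, i ≤ f i := fun i => h.2.2 _ _ (hf i ▸ hadj (a i))
  have hinj : Function.Injective f := fun i j hij => by
    have h1 : a i = a j := hτ.injective (by rw [← hf, ← hf, hij])
    simpa using @h.1.1 (Sum.inl i) (Sum.inl j) h1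
  have hsum : ∑ j, ((j : Fin t) : ℕ) = ∑ j, (f j : ℕ) :=
    ((Equiv.ofBijective f (Finite.injective_iff_bijective.1 hinj)).sum_comp
      fun j : Fin t => (j : ℕ)).symm
  have := (Finset.sum_eq_sum_iff_of_le fun j _ => Fin.le_def.1 (hle j)).1 hsum i
    (Finset.mem_univ i)
  rw [← hf i, ← Fin.ext this]

lemma exists_separates_of_isOrderedMatching [Fintype σ] {G : SimpleGraph σ}
    (hτ : Function.Involutive τ) (hadj : ∀ p, G.Adj p (τ p)) (h : IsOrderedMatching G a b)
    (hs : Function.Surjective (Sum.elim a b)) {m : ℕ} (hm : 2 * t ≤ m) :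
    ∃ α, Separates (graphWeight G m) Finset.univ τ α := by
  have hab := partner_eq_of_isOrderedMatching hτ hadj h hs
  let e := Equiv.ofBijective _ ⟨h.1.1, hs⟩
  let α : σ → ℕ := fun p =>
    Sum.elim (fun i : Fin t => t - 1 - (i : ℕ)) (fun i : Fin t => m - t + (i : ℕ)) (e.symm p)
  have hα : ∀ z, α (Sum.elim a b z) = Sum.elim (fun i : Fin t => t - 1 - (i : ℕ))
    (fun i : Fin t => m - t + (i : ℕ)) z := fun z => congrArg _ (e.symm_apply_apply z)
  have hαa : ∀ i, α (a i) = t - 1 - (i : ℕ) := fun i => hα (Sum.inl i)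
  have hαb : ∀ i, α (b i) = m - t + (i : ℕ) := fun i => hα (Sum.inr i)
  refine ⟨α, (separates_graphWeight_iff hadj).2 ⟨fun p => ?_, fun p q hpq hq => ?_⟩⟩
  · obtain ⟨i | i, rfl⟩ := hs p <;> simp only [Sum.elim_inl, Sum.elim_inr]
    · rw [hab, hαa, hαb]
      omega
    · rw [← hab, hτ, hab, hαa, hαb]
      omega
  · have key : ∀ i j, G.Adj (a i) (b j) → b j ≠ τ (a i) → m ≤ α (a i) + α (b j) := by
      intro i j hij hne
      have h1 := Fin.le_def.1 (h.2.2 i j hij)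
      have h2 : (i : ℕ) ≠ j := fun h2 => hne (by rw [hab, Fin.ext h2])
      rw [hαa, hαb]
      omega
    obtain ⟨i | i, rfl⟩ := hs p <;> obtain ⟨j | j, rfl⟩ := hs q <;>
      simp only [Sum.elim_inl, Sum.elim_inr] at *
    · exact absurd hpq (h.2.1 i j)
    · exact key i j hpq hq
    · rw [add_comm]
      exact key j i hpq.symm fun h1 => hq (by rw [h1, hτ])
    · rw [hαb, hαb]
      omega

lemma Separates.exists_of_le [Fintype σ] {G : SimpleGraph σ} (hτ : Function.Involutive τ)
    (hadj : ∀ p, G.Adj p (τ p)) (h : IsOrderedMatching G a b)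
    (hs : Function.Surjective (Sum.elim a b)) (hab : ∀ i, τ (a i) = b i) {m n : ℕ} (hnm : n ≤ m)
    {α : σ → ℕ} (hα : Separates (graphWeight G n) Finset.univ τ α) :
    ∃ α, Separates (graphWeight G m) Finset.univ τ α := by
  classical
  rw [separates_graphWeight_iff hadj] at hα
  let β : σ → ℕ := fun p => α p + if p ∈ Set.range b then m - n else 0
  have hβa : ∀ i, β (a i) = α (a i) := fun i => by
    have : a i ∉ Set.range b := fun ⟨j, hj⟩ => by
      simpa using @h.1.1 (Sum.inr j) (Sum.inl i) hj
    simp only [β, if_neg this, add_zero]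
  have hβb : ∀ i, β (b i) = α (b i) + (m - n) := fun i => by
    simp only [β, if_pos (Set.mem_range_self i)]
  refine ⟨β, (separates_graphWeight_iff hadj).2 ⟨fun p => ?_, fun p q hpq hq => ?_⟩⟩
  · have := hα.1 p
    obtain ⟨i | i, rfl⟩ := hs p <;> simp only [Sum.elim_inl, Sum.elim_inr] at *
    · rw [hab] at *
      rw [hβa, hβb]
      omega
    · rw [← hab, hτ, hab] at *
      rw [hβa, hβb]
      omega
  · have := hα.2 p q hpq hq
    obtain ⟨i | i, rfl⟩ := hs p <;> obtain ⟨j | j, rfl⟩ := hs q <;>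
      simp only [Sum.elim_inl, Sum.elim_inr] at *
    · exact absurd hpq (h.2.1 i j)
    all_goals
      simp only [hβa, hβb]
      omega

variable {K : Type u} [Field K] [Fintype σ] {G : SimpleGraph σ} {d n : ℕ}

lemma depthQ_symbPow_of_separates (hcard : Fintype.card σ = 2 * (d + 1))
    (hτ : Function.Involutive τ) (hτ' : ∀ p, τ p ≠ p) (hadj : ∀ p, G.Adj p (τ p)) (hn : n ≠ 0)
    {α : σ → ℕ} (hα : Separates (graphWeight G n) Finset.univ τ α) :
    depthQ K (symbPow K G n) = d := by
  classical
  obtain ⟨p⟩ : Nonempty σ := Fintype.card_pos_iff.1 (by omega)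
  have hw := isWeight_graphWeight G n
  exact depthQ_eq_of_monoVanish (symbPow_eq_monoIdeal G n) (symbPow_le_span_range_X (hadj p) hn)
    (monoVanish_edgeSet_of_card d hw (by rw [Finset.card_univ]; omega))
    (not_monoVanish_of_separates hτ hτ' hw (fun _ _ => Finset.mem_univ _) hcard hα)

lemma exists_separates_of_depthQ (hcard : Fintype.card σ = 2 * (d + 1)) (hd : d ≠ 0)
    (hτ : Function.Involutive τ) (hτ' : ∀ p, τ p ≠ p) (hadj : ∀ p, G.Adj p (τ p)) (hn : n ≠ 0)
    (h : IsOrderedMatching G a b) (hs : Function.Surjective (Sum.elim a b))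
    (hdepth : depthQ K (symbPow K G n) = d) :
    ∃ α, Separates (graphWeight G n) Finset.univ τ α := by
  classical
  have hab := partner_eq_of_isOrderedMatching hτ hadj h hs
  obtain ⟨p⟩ : Nonempty σ := Fintype.card_pos_iff.1 (by omega)
  refine (monoVanish_or_exists_separates hτ hτ' (d + 1) (isWeight_graphWeight G n)
    (fun _ _ => Finset.mem_univ _) hcard fun L _ hne hL => ?_).resolve_left
    (not_monoVanish_of_depthQ_eq (symbPow_eq_monoIdeal G n)
      (symbPow_le_span_range_X (hadj p) hn) hd hdepth)
  have hne' : (Finset.univ.filter fun i => a i ∈ L).Nonempty := by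
    obtain ⟨q, hq⟩ := hne
    obtain ⟨i | i, rfl⟩ := hs q
    · exact ⟨i, by simpa using hq⟩
    · refine ⟨i, ?_⟩
      have := hL _ hq
      rw [Sum.elim_inr, ← hab, hτ] at this
      simpa using this
  obtain ⟨i, hi, hmax⟩ := Finset.exists_max_image _ id hne'
  refine ⟨a i, (Finset.mem_filter.1 hi).2, fun q hq hqi =>
    graphWeight_of_not_adj (fun hadj' => ?_) _⟩
  obtain ⟨j | j, rfl⟩ := hs q
  · exact h.2.1 i j hadj'
  · have hj := hL _ hq
    rw [Sum.elim_inr, ← hab, hτ] at hj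
    have h1 : j ≤ i := hmax j (Finset.mem_filter.2 ⟨Finset.mem_univ _, hj⟩)
    refine hqi ?_
    rw [hab, le_antisymm h1 (h.2.2 i j hadj'), Sum.elim_inr]

end PerfectMatchings

end DS

/-- Let `G` be a graph on `2t` vertices with a perfect matching `M` (of size `t`,
presented by the endpoint functions `a`, `b`) and let `n ≥ 1`. Then there is
`α ∈ ℕ^{2t}` with `α_x + α_y ≤ n − 1` for every edge `{x,y} ∈ M` and `α_x + α_y ≥ n`
for every edge `{x,y} ∈ E(G) ∖ M`, if and only if `ν₀(G) = t` and `n ≥ sdst(J(G))`. -/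
theorem stmt_8 (K : Type*) [Field K] {t : ℕ} (G : SimpleGraph (Fin (2 * t)))
    (a b : Fin t → Fin (2 * t))
    (hM : DS.IsMatchingPair G a b)
    (hperf : Function.Surjective (Sum.elim a b))
    (n : ℕ) (hn : 1 ≤ n) :
    (∃ α : Fin (2 * t) → ℕ,
        (∀ i, α (a i) + α (b i) ≤ n - 1) ∧
        (∀ x y : Fin (2 * t), G.Adj x y → s(x, y) ∉ DS.omEdges a b → n ≤ α x + α y)) ↔
      (DS.nu0 G = t ∧ DS.sdst K G ≤ n) := by
  have hbij : Function.Bijective (Sum.elim a b) := ⟨hM.1, hperf⟩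
  have hcard : Fintype.card (Fin (2 * t)) = 2 * t := Fintype.card_fin _
  obtain ⟨τ, hτ, hτ', hab⟩ := DS.exists_partner hbij
  have hadj := DS.adj_partner hτ hperf hab hM.2
  have hnu : ∀ u v : Fin t → Fin (2 * t), DS.IsOrderedMatching G u v → DS.nu0 G = t :=
    fun u v h => IsGreatest.csSup_eq ⟨⟨u, v, h⟩, DS.mem_upperBounds_orderedMatching G hcard⟩
  have hα : (∃ α : Fin (2 * t) → ℕ, (∀ i, α (a i) + α (b i) ≤ n - 1) ∧
      ∀ x y : Fin (2 * t), G.Adj x y → s(x, y) ∉ DS.omEdges a b → n ≤ α x + α y) ↔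
      ∃ α, DS.Separates (DS.graphWeight G n) Finset.univ τ α := by
    refine exists_congr fun α => ?_
    rw [DS.separates_graphWeight_iff hadj]
    simp only [DS.mem_omEdges_iff_eq_partner hτ hperf hab]
    refine and_congr_left fun _ => ⟨fun h p => ?_, fun h i => ?_⟩
    · obtain ⟨i | i, rfl⟩ := hperf p
      · have := h i
        rw [Sum.elim_inl, hab]
        omega
      · have := h i
        rw [Sum.elim_inr, ← hab, hτ, hab]
        omega
    · have := h (a i)
      rw [hab] at this
      omega
  rw [hα]
  constructor
  · rintro ⟨α, hsep⟩
    obtain ⟨u, v, huv, htau⟩ :=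
      DS.exists_orderedMatching_of_separates hcard hτ hperf hab hadj hsep
    have hs := (DS.bijective_sumElim_of_injective hcard huv.1.1).2
    refine ⟨hnu u v huv, Nat.sInf_le ⟨hn, fun m hm => ?_⟩⟩
    rw [hnu u v huv, hcard]
    rcases t with _ | d
    · rw [show DS.symbPow K G m = ⊤ from iInf₂_eq_top.2 fun p _ => p.1.elim0, DS.depthQ_top]
    · obtain ⟨β, hβ⟩ := hsep.exists_of_le hτ hadj huv hs htau hm
      rw [DS.depthQ_symbPow_of_separates hcard hτ hτ' hadj (by omega) hβ]
      omega
  · rintro ⟨hnu0, hsdst⟩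
    obtain ⟨u, v, huv⟩ : ∃ u v : Fin t → Fin (2 * t), DS.IsOrderedMatching G u v := by
      have h := Nat.sSup_mem (s := {s | ∃ u v : Fin s → Fin (2 * t), DS.IsOrderedMatching G u v})
        ⟨0, Fin.elim0, Fin.elim0, ⟨Function.injective_of_subsingleton _, fun i => i.elim0⟩,
          fun i => i.elim0, fun i => i.elim0⟩ ⟨t, DS.mem_upperBounds_orderedMatching G hcard⟩
      rwa [show sSup _ = t from hnu0] at h
    have hs := (DS.bijective_sumElim_of_injective hcard huv.1.1).2
    rcases t with _ | _ | d
    · exact ⟨0, fun p => p.elim0, fun p => p.elim0⟩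
    · refine ⟨0, (DS.separates_graphWeight_iff hadj).2 ⟨fun p => hn, fun p q hpq hq => ?_⟩⟩
      have h1 := hpq.ne
      have h2 := hτ' p
      omega
    · refine DS.exists_separates_of_depthQ (K := K) hcard (Nat.succ_ne_zero d) hτ hτ' hadj
        (by omega) huv hs ?_
      have hmem := Nat.sInf_mem (s := {n0 | 1 ≤ n0 ∧ ∀ n, n0 ≤ n →
        DS.depthQ K (DS.symbPow K G n) = Fintype.card (Fin (2 * (d + 1 + 1))) - DS.nu0 G - 1}) ?_
      · rw [hmem.2 n hsdst, hcard, hnu0]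
        omega
      · refine ⟨2 * (d + 2), by omega, fun m hm => ?_⟩
        obtain ⟨β, hβ⟩ := DS.exists_separates_of_isOrderedMatching hτ hadj huv hs hm
        rw [DS.depthQ_symbPow_of_separates hcard hτ hτ' hadj (by omega) hβ, hcard, hnu0]
        omega
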